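/- There is no permutation σ of {1,…,8} whose cycle type is (5, 3) (i.e., σ is a product of a disjoint 5-cycle and 3-cycle) such that the longest increasing subsequence of σ has length 2 and the longest decreasing subsequence of σ has length 4. -/

import Mathlib

open Equiv

/-- `s` is (the index set of) an increasing subsequence of the permutation `σ`. -/
def IsIncSubseq {n : ℕ} (σ : Perm (Fin n)) (s : Finset (Fin n)) : Prop :=
  ∀ i ∈ s, ∀ j ∈ s, i < j → σ i < σ j

/-- `s` is (the index set of) a decreasing subsequence of the permutation `σ`. -/
def IsDecSubseq {n : ℕ} (σ : Perm (Fin n)) (s : Finset (Fin n)) : Prop :=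
  ∀ i ∈ s, ∀ j ∈ s, i < j → σ j < σ i

/-- The cycle type of `σ`, counting each fixed point as a cycle of length `1`. -/
def fullCycleType {n : ℕ} (σ : Perm (Fin n)) : Multiset ℕ :=
  σ.cycleType + Multiset.replicate (n - σ.cycleType.sum) 1

/-- `l` has a sublist of length `k` which forms a chain for `r` when preceded by `x`. -/
def hasChain (r : ℕ → ℕ → Bool) : ℕ → ℕ → List ℕ → Bool
  | 0, _, _ => true
  | _ + 1, _, [] => false
  | k + 1, x, y :: l => r x y && hasChain r k y l || hasChain r (k + 1) x l

/-- Appending `a` to the word whose reversal is `l` creates no repeated value, no fixed point,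
no `2`-cycle, no increasing subsequence of length `3` and no decreasing one of length `5`. -/
def extendsTo (a : ℕ) (l : List ℕ) : Bool :=
  !l.elem a && a != l.length && l.reverse[a]? != some l.length &&
    !hasChain (fun x y => y < x) 2 a l && !hasChain (fun x y => x < y) 4 a l

/-- No extension by `k` letters below `8`, each satisfying `extendsTo`, of the word whose reversal
is `l` is a function whose fifteenth iterate fixes `0`. -/
def noExtension : ℕ → List ℕ → Bool
  | 0, l => (l.reverse.getD · 0)^[15] 0 != 0
  | k + 1, l => [0, 1, 2, 3, 4, 5, 6, 7].all fun a => !extendsTo a l || noExtension k (a :: l)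

theorem noExtension_nil : noExtension 8 [] = true := by
  decide +kernel

/-- The values of `f` below `m`, in decreasing order of the arguments. -/
def reverseWord (f : ℕ → ℕ) (m : ℕ) : List ℕ :=
  ((List.range m).map f).reverse

theorem reverseWord_succ (f : ℕ → ℕ) (m : ℕ) :
    reverseWord f (m + 1) = f m :: reverseWord f m := by
  simp [reverseWord, List.range_succ]

theorem exists_of_hasChain_succ {r : ℕ → ℕ → Bool} {f : ℕ → ℕ} {k x m : ℕ}
    (h : hasChain r (k + 1) x (reverseWord f m)) :
    ∃ j < m, r x (f j) ∧ hasChain r k (f j) (reverseWord f j) := by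
  induction m with
  | zero => simp [reverseWord, hasChain] at h
  | succ m ih =>
    simp only [reverseWord_succ, hasChain, Bool.or_eq_true, Bool.and_eq_true] at h
    rcases h with h | h
    · exact ⟨m, m.lt_succ_self, h⟩
    · obtain ⟨j, hj, h⟩ := ih h
      exact ⟨j, hj.trans m.lt_succ_self, h⟩

theorem iterate_ne_zero_of_noExtension {f : ℕ → ℕ} (hlt : ∀ m, f m < 8)
    (hzero : ∀ m ≥ 8, f m = 0) (hext : ∀ m < 8, extendsTo (f m) (reverseWord f m)) {k m : ℕ}
    (hkm : m + k = 8) (h : noExtension k (reverseWord f m)) : f^[15] 0 ≠ 0 := by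
  induction k generalizing m with
  | zero =>
    obtain rfl : m = 8 := by omega
    have hf : ((reverseWord f 8).reverse.getD · 0) = f := by
      funext i
      rcases lt_or_ge i 8 with hi | hi
      · simp [reverseWord, List.getD_eq_getElem?_getD, hi]
      · rw [hzero i hi]
        exact List.getD_eq_default _ _ (by simpa [reverseWord] using hi)
    rw [noExtension, hf] at h
    simpa using h
  | succ k ih =>
    refine ih (m := m + 1) (by omega) ?_
    rw [noExtension, List.all_eq_true] at h
    have hmem : f m ∈ [0, 1, 2, 3, 4, 5, 6, 7] := by
      have := hlt m
      simp only [List.mem_cons, List.not_mem_nil]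
      omega
    simpa [hext m (by omega), reverseWord_succ] using h (f m) hmem

theorem extendsTo_reverseWord {f : ℕ → ℕ} {m : ℕ} (hinj : ∀ i < m, f i ≠ f m) (hfix : f m ≠ m)
    (htwo : f m < m → f (f m) ≠ m)
    (hinc : ∀ j < m, f j < f m → ∀ i < j, ¬ f i < f j)
    (hdec : ∀ b < m, f m < f b → ∀ c < b, f b < f c → ∀ d < c, f c < f d → ∀ e < d, ¬ f d < f e) :
    extendsTo (f m) (reverseWord f m) := by
  have hlen : (reverseWord f m).length = m := by simp [reverseWord]
  simp only [extendsTo, hlen, Bool.and_eq_true, Bool.not_eq_true', bne_iff_ne]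
  refine ⟨⟨⟨⟨?_, hfix⟩, ?_⟩, ?_⟩, ?_⟩
  · simpa [reverseWord] using hinj
  · simpa [reverseWord, List.getElem?_eq_some_iff] using htwo
  · refine Bool.eq_false_iff.2 fun h => ?_
    obtain ⟨j, hj, hjm, h⟩ := exists_of_hasChain_succ h
    obtain ⟨i, hi, hij, -⟩ := exists_of_hasChain_succ h
    exact hinc j hj (of_decide_eq_true hjm) i hi (of_decide_eq_true hij)
  · refine Bool.eq_false_iff.2 fun h => ?_
    obtain ⟨b, hb, hbm, h⟩ := exists_of_hasChain_succ h
    obtain ⟨c, hc, hcb, h⟩ := exists_of_hasChain_succ h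
    obtain ⟨d, hd, hdc, h⟩ := exists_of_hasChain_succ h
    obtain ⟨e, he, hed, -⟩ := exists_of_hasChain_succ h
    exact hdec b hb (of_decide_eq_true hbm) c hc (of_decide_eq_true hcb) d hd
      (of_decide_eq_true hdc) e he (of_decide_eq_true hed)

/-- A permutation of `Fin n` as a function on `ℕ`, with value `0` outside of `Fin n`. -/
def Equiv.Perm.natFun {n : ℕ} (σ : Perm (Fin n)) (i : ℕ) : ℕ :=
  if h : i < n then σ ⟨i, h⟩ else 0

theorem Equiv.Perm.natFun_val {n : ℕ} (σ : Perm (Fin n)) (i : Fin n) : σ.natFun i = σ i := by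
  simp [Equiv.Perm.natFun]

theorem Equiv.Perm.natFun_iterate_val {n : ℕ} (σ : Perm (Fin n)) (k : ℕ) (i : Fin n) :
    σ.natFun^[k] i = (σ ^ k) i := by
  induction k with
  | zero => rfl
  | succ k ih => rw [Function.iterate_succ_apply', ih, natFun_val, pow_succ', Perm.mul_apply]

theorem cycleType_eq_of_fullCycleType_eq {n : ℕ} {σ : Perm (Fin n)} {s : Multiset ℕ}
    (h : fullCycleType σ = s) (hs : 1 ∉ s) : σ.cycleType = s := by
  have hrep : n - σ.cycleType.sum = 0 := by
    by_contra hne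
    exact hs (h ▸ Multiset.mem_add.2 (Or.inr (Multiset.mem_replicate.2 ⟨hne, rfl⟩)))
  simpa [fullCycleType, hrep] using h

theorem Equiv.Perm.apply_ne_self_of_sum_cycleType {n : ℕ} {σ : Perm (Fin n)}
    (h : σ.cycleType.sum = n) (x : Fin n) : σ x ≠ x := by
  rw [Perm.sum_cycleType] at h
  have huniv : σ.support = Finset.univ := by
    rw [← Finset.card_eq_iff_eq_univ, h, Fintype.card_fin]
  exact Perm.mem_support.1 (huniv ▸ Finset.mem_univ x)

theorem Equiv.Perm.apply_apply_ne_self_of_pow_odd {α : Type*} {σ : Perm α} {k : ℕ}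
    (hk : σ ^ (2 * k + 1) = 1) {x : α} (hx : σ x ≠ x) : σ (σ x) ≠ x := by
  intro h2
  have hsq : (σ ^ 2) x = x := h2
  have hfix : ((σ ^ 2) ^ k) x = x := by
    rw [← Perm.iterate_eq_pow]
    exact Function.iterate_fixed hsq k
  refine hx ?_
  have := congrArg (· x) hk
  rwa [pow_succ', pow_mul, Perm.mul_apply, hfix] at this

theorem not_lt_of_forall_isIncSubseq {n : ℕ} {σ : Perm (Fin n)}
    (h : ∀ s, IsIncSubseq σ s → s.card ≤ 2) {i j k : Fin n} (hij : i < j) (hjk : j < k)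
    (hσ : σ j < σ k) : ¬ σ i < σ j := by
  intro hσ'
  have hcard := h {i, j, k} (by
    unfold IsIncSubseq
    grind)
  rw [Finset.card_eq_three.2 ⟨i, j, k, hij.ne, (hij.trans hjk).ne, hjk.ne, rfl⟩] at hcard
  omega

theorem not_lt_of_forall_isDecSubseq {n : ℕ} {σ : Perm (Fin n)}
    (h : ∀ s, IsDecSubseq σ s → s.card ≤ 4) {a b c d e : Fin n} (hba : b < a) (hcb : c < b)
    (hdc : d < c) (hed : e < d) (hab : σ a < σ b) (hbc : σ b < σ c) (hcd : σ c < σ d) :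
    ¬ σ d < σ e := by
  intro hde
  have hcard := h {a, b, c, d, e} (by
    intro i hi j hj hij
    simp only [Finset.mem_insert, Finset.mem_singleton] at hi hj
    rcases hi with rfl | rfl | rfl | rfl | rfl <;>
      rcases hj with rfl | rfl | rfl | rfl | rfl <;> order)
  have : ({a, b, c, d, e} : Finset (Fin n)).card = 5 := by
    repeat rw [Finset.card_insert_of_notMem (by grind)]
    simp
  omega

/-- No permutation of `{1,…,8}` with cycle type `(5, 3)` has longest increasing
subsequence of length `2` and longest decreasing subsequence of length `4`. -/
theorem no_perm_cycleType_five_three_shape_two_four :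
    ¬ ∃ σ : Perm (Fin 8),
      fullCycleType σ = {5, 3} ∧
      ((∃ s, IsIncSubseq σ s ∧ s.card = 2) ∧
        (∀ s, IsIncSubseq σ s → s.card ≤ 2)) ∧
      ((∃ s, IsDecSubseq σ s ∧ s.card = 4) ∧
        (∀ s, IsDecSubseq σ s → s.card ≤ 4)) := by
  rintro ⟨σ, hct, ⟨-, hinc⟩, -, hdec⟩
  have hcyc : σ.cycleType = {5, 3} := cycleType_eq_of_fullCycleType_eq hct (by decide)
  have hfix : ∀ x, σ x ≠ x := Perm.apply_ne_self_of_sum_cycleType (by rw [hcyc]; rfl)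
  have hpow : σ ^ 15 = 1 := by
    have horder : orderOf σ = 15 := by
      rw [← Perm.lcm_cycleType, hcyc]
      rfl
    rw [← horder, pow_orderOf_eq_one]
  have htwo : ∀ x, σ (σ x) ≠ x := fun x =>
    Perm.apply_apply_ne_self_of_pow_odd (k := 7) hpow (hfix x)
  have hval : ∀ i (hi : i < 8), σ.natFun i = σ ⟨i, hi⟩ := fun i hi => σ.natFun_val ⟨i, hi⟩
  refine iterate_ne_zero_of_noExtension (f := σ.natFun) (k := 8) (m := 0) (fun m => ?_)
    (fun m hm => dif_neg (by omega))
    (fun m hm => extendsTo_reverseWord (fun i hi => ?_) ?_ (fun _ => ?_) (fun j hj hjm i hi => ?_)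
      fun b hb hab c hc hbc d hd hcd e he => ?_) rfl noExtension_nil ?_
  · unfold Perm.natFun
    split <;> omega
  · rw [hval m hm, hval i (by omega)]
    intro h
    have := σ.injective (Fin.ext h)
    simp only [Fin.mk.injEq] at this
    omega
  · rw [hval m hm]
    exact fun h => hfix ⟨m, hm⟩ (Fin.ext h)
  · rw [hval m hm, Perm.natFun_val]
    exact fun h => htwo ⟨m, hm⟩ (Fin.ext h)
  · rw [hval m hm, hval j (by omega)] at hjm
    rw [hval i (by omega), hval j (by omega)]
    exact not_lt_of_forall_isIncSubseq hinc (Fin.mk_lt_mk.2 hi) (Fin.mk_lt_mk.2 hj) hjm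
  · rw [hval m hm, hval b (by omega)] at hab
    rw [hval b (by omega), hval c (by omega)] at hbc
    rw [hval c (by omega), hval d (by omega)] at hcd
    rw [hval d (by omega), hval e (by omega)]
    exact not_lt_of_forall_isDecSubseq hdec (Fin.mk_lt_mk.2 hb) (Fin.mk_lt_mk.2 hc)
      (Fin.mk_lt_mk.2 hd) (Fin.mk_lt_mk.2 he) hab hbc hcd
  · have h := σ.natFun_iterate_val 15 0
    rwa [hpow] at h
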